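/- Fix constants v, α, r_d, c4 > 0, c1 > 0, 0 < c3 < αv, s_d ∈ ℝ, and t0 ∈ ℝ. Let r, φ : [t0, ∞) → ℝ be differentiable with r(t) > 0 for all t ≥ t0 and φ(t0) ∈ [-π, 0], satisfying ṙ(t) = v cos φ(t) and φ̇(t) = c1(-αv cos φ(t) - c3 tanh(α(r(t) - r_d)/c4)) - (v/r(t)) sin φ(t) for all t ≥ t0, and set s(t) = s_d - α(r(t) - r_d). Let r_e be the unique positive root of g(r) = -tanh(α(r - r_d)/c4) + v/(c1·c3·r) and s_e = s_d - α(r_e - r_d). Then there exist a finite time t1 ≥ t0 and positive constants C and ρ such that for all t > t1, ‖(s(t) - s_e, φ(t) + π/2)‖ ≤ C·‖(s(t1) - s_e, φ(t1) + π/2)‖·exp(-ρ(t - t1)). -/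

import Mathlib

open Real

theorem tanh_strictMono_real : StrictMono Real.tanh := by
  intro x y hxy
  rw [Real.tanh_eq_sinh_div_cosh, Real.tanh_eq_sinh_div_cosh,
    div_lt_div_iff₀ (Real.cosh_pos x) (Real.cosh_pos y)]
  have h : 0 < Real.sinh (y - x) := Real.sinh_pos_iff.2 (sub_pos.2 hxy)
  rw [Real.sinh_sub] at h
  linarith

theorem continuous_tanh_real : Continuous Real.tanh := by
  have h : Real.tanh = fun x => Real.sinh x / Real.cosh x :=
    funext Real.tanh_eq_sinh_div_cosh
  rw [h]
  exact Real.continuous_sinh.div Real.continuous_cosh fun x => (Real.cosh_pos x).ne'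

/-- A function on the line whose derivative has the sign of `x - p` between `p` and `q`
satisfies `F p ≤ F q`. -/
theorem le_of_deriv_mul_sub_nonneg {F F' : ℝ → ℝ} {p q : ℝ}
    (hF : ∀ x, HasDerivAt F (F' x) x) (h : ∀ x ∈ Set.uIcc p q, 0 ≤ F' x * (x - p)) :
    F p ≤ F q := by
  have hc : Continuous F := continuous_iff_continuousAt.2 fun x => (hF x).continuousAt
  rcases lt_trichotomy p q with hpq | rfl | hpq
  · obtain ⟨c, hcm, hcs⟩ := exists_hasDerivAt_eq_slope F F' hpq hc.continuousOn fun x _ => hF x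
    have h1 := h c (Set.mem_uIcc.2 (Or.inl ⟨hcm.1.le, hcm.2.le⟩))
    have h2 : 0 ≤ F' c := nonneg_of_mul_nonneg_left h1 (sub_pos.2 hcm.1)
    rw [hcs, le_div_iff₀ (sub_pos.2 hpq)] at h2
    linarith
  · exact le_rfl
  · obtain ⟨c, hcm, hcs⟩ := exists_hasDerivAt_eq_slope F F' hpq hc.continuousOn fun x _ => hF x
    have h1 := h c (Set.mem_uIcc.2 (Or.inr ⟨hcm.1.le, hcm.2.le⟩))
    have h2 : F' c ≤ 0 := nonpos_of_mul_nonneg_left h1 (sub_neg.2 hcm.2)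
    rw [hcs, div_le_iff₀ (sub_pos.2 hpq)] at h2
    linarith

/-- A differentiable function that is decreasing whenever it equals `M` stays below `M`. -/
theorem le_of_deriv_neg_at_level {f f' : ℝ → ℝ} {t₀ M : ℝ}
    (hf : ∀ t, t₀ ≤ t → HasDerivAt f (f' t) t) (h0 : f t₀ ≤ M)
    (hM : ∀ t, t₀ ≤ t → f t = M → f' t < 0) {t : ℝ} (ht : t₀ ≤ t) : f t ≤ M :=
  image_le_of_deriv_right_lt_deriv_boundary (a := t₀) (b := t) (B := fun _ => M)
    (B' := fun _ => 0) (fun x hx => (hf x hx.1).continuousAt.continuousWithinAt)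
    (fun x hx => (hf x hx.1).hasDerivWithinAt) h0 (fun x => hasDerivAt_const x M)
    (fun x hx => hM x hx.1) ⟨ht, le_rfl⟩

theorem antitoneOn_Ici_of_hasDerivAt_nonpos {f f' : ℝ → ℝ} {t₀ : ℝ}
    (hf : ∀ t, t₀ ≤ t → HasDerivAt f (f' t) t) (hf' : ∀ t, t₀ ≤ t → f' t ≤ 0) :
    AntitoneOn f (Set.Ici t₀) := by
  refine antitoneOn_of_hasDerivWithinAt_nonpos (f' := f') (convex_Ici t₀)
    (fun t ht => (hf t ht).continuousAt.continuousWithinAt) ?_ ?_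
  · intro t ht
    rw [interior_Ici] at ht
    exact (hf t (le_of_lt ht)).hasDerivWithinAt
  · intro t ht
    rw [interior_Ici] at ht
    exact hf' t (le_of_lt ht)

theorem le_mul_exp_of_deriv_le_neg_mul {W W' : ℝ → ℝ} {t₀ ρ : ℝ}
    (hW : ∀ t, t₀ ≤ t → HasDerivAt W (W' t) t) (hW' : ∀ t, t₀ ≤ t → W' t ≤ -ρ * W t)
    {t : ℝ} (ht : t₀ ≤ t) : W t ≤ W t₀ * Real.exp (-ρ * (t - t₀)) := by
  have hanti : AntitoneOn (fun t => W t * Real.exp (ρ * (t - t₀))) (Set.Ici t₀) := by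
    refine antitoneOn_Ici_of_hasDerivAt_nonpos
      (f' := fun t => (W' t + ρ * W t) * Real.exp (ρ * (t - t₀))) ?_ ?_
    · intro t ht
      have h1 : HasDerivAt (fun t => Real.exp (ρ * (t - t₀)))
          (Real.exp (ρ * (t - t₀)) * (ρ * 1)) t :=
        (((hasDerivAt_id t).sub_const t₀).const_mul ρ).exp
      exact ((hW t ht).mul h1).congr_deriv (by ring)
    · intro t ht
      exact mul_nonpos_of_nonpos_of_nonneg (by linarith [hW' t ht]) (Real.exp_pos _).le
  have h := hanti Set.self_mem_Ici ht ht
  simp only [sub_self, mul_zero, Real.exp_zero, mul_one] at h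
  have he : Real.exp (ρ * (t - t₀)) * Real.exp (-ρ * (t - t₀)) = 1 := by
    rw [← Real.exp_add]; simp
  calc W t = W t * Real.exp (ρ * (t - t₀)) * Real.exp (-ρ * (t - t₀)) := by
        rw [mul_assoc, he, mul_one]
    _ ≤ _ := mul_le_mul_of_nonneg_right h (Real.exp_pos _).le

section Potential

variable {h G : ℝ → ℝ} {v re : ℝ}

/-- The radial force balance `h r - v / r` is at least as steep as `-v / r`. -/
theorem div_mul_sq_le_force (hmono : Monotone h) (hre : 0 < re) (hbal : re * h re = v)
    {x : ℝ} (hx : 0 < x) : v / (x * re) * (x - re) ^ 2 ≤ (x - re) * (h x - v / x) := by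
  have h1 : 0 ≤ (x - re) * (h x - h re) := by
    rcases le_total re x with hle | hle
    · exact mul_nonneg (sub_nonneg.2 hle) (sub_nonneg.2 (hmono hle))
    · exact mul_nonneg_of_nonpos_of_nonpos (sub_nonpos.2 hle) (sub_nonpos.2 (hmono hle))
  have h2 : (x - re) * (h re - v / x) = v / (x * re) * (x - re) ^ 2 := by
    rw [← hbal]; field_simp
  linarith [show (x - re) * (h x - v / x) = (x - re) * (h x - h re) + (x - re) * (h re - v / x)
    by ring]

theorem quadratic_le_potential (hv : 0 < v) (hmono : Monotone h) (hre : 0 < re)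
    (hbal : re * h re = v) (hG : ∀ x, HasDerivAt G (x * h x - v) x) (hGre : G re = 0)
    {x : ℝ} (hx : 0 < x) : v / (2 * re) * (x - re) ^ 2 ≤ G x := by
  have key := le_of_deriv_mul_sub_nonneg (p := re) (q := x)
    (F := fun x => G x - v / (2 * re) * (x - re) ^ 2)
    (F' := fun x => x * h x - v - v / re * (x - re)) ?_ ?_
  · simp only [hGre, sub_self] at key
    linarith
  · intro y
    have h1 := ((((hasDerivAt_id y).sub_const re).pow 2).const_mul (v / (2 * re)))
    exact ((hG y).sub h1).congr_deriv (by simp; field_simp)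
  · intro y hy
    have hy0 : 0 < y := lt_of_lt_of_le (lt_min hre hx) hy.1
    have h1 := mul_le_mul_of_nonneg_left (div_mul_sq_le_force hmono hre hbal hy0) hy0.le
    have h2 : y * (v / (y * re) * (y - re) ^ 2) = v / re * (y - re) * (y - re) := by
      field_simp
    have h3 : y * ((y - re) * (h y - v / y)) = (y * h y - v) * (y - re) := by
      field_simp
    rw [h2, h3] at h1
    linarith

theorem potential_le_force (hv : 0 < v) (hmono : Monotone h) (hre : 0 < re)
    (hbal : re * h re = v) (hG : ∀ x, HasDerivAt G (x * h x - v) x) (hGre : G re = 0)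
    {x b : ℝ} (hx : 0 < x) (hxb : x ≤ b) (hreb : re ≤ b) :
    G x ≤ b * ((x - re) * (h x - v / x)) := by
  have hk : ∀ {y z : ℝ}, 0 < y → y ≤ z → h y - v / y ≤ h z - v / z := fun hy hyz =>
    sub_le_sub (hmono hyz) (div_le_div_of_nonneg_left hv.le hy hyz)
  have hkre : h re - v / re = 0 := by rw [← hbal]; field_simp; ring
  have key := le_of_deriv_mul_sub_nonneg (p := re) (q := x)
    (F := fun y => b * (h x - v / x) * (y - re) - G y)
    (F' := fun y => b * (h x - v / x) - (y * h y - v)) ?_ ?_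
  · simp only [hGre, sub_self] at key
    linarith
  · intro y
    have h1 := (((hasDerivAt_id y).sub_const re).const_mul (b * (h x - v / x)))
    exact (h1.sub (hG y)).congr_deriv (by simp)
  · intro y hy
    have hy0 : 0 < y := lt_of_lt_of_le (lt_min hre hx) hy.1
    have hyk : y * h y - v = y * (h y - v / y) := by field_simp
    rw [hyk]
    rcases Set.mem_uIcc.1 hy with ⟨h1, h2⟩ | ⟨h1, h2⟩
    · refine mul_nonneg (sub_nonneg.2 ?_) (sub_nonneg.2 h1)
      have := hk hre h1
      exact mul_le_mul (h2.trans hxb) (hk hy0 h2) (by linarith) (by linarith)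
    · refine mul_nonneg_of_nonpos_of_nonpos (sub_nonpos.2 ?_) (sub_nonpos.2 h2)
      have h3 := hk hy0 h2
      have h4 := hk hx h1
      nlinarith [mul_nonneg (sub_nonneg.2 (h2.trans hreb)) (show 0 ≤ -(h y - v / y) by linarith),
        mul_nonneg (show 0 ≤ b by linarith) (sub_nonneg.2 h4)]

/-- Strict Lyapunov inequalities on a compact annulus: the energy
`G r + v r (1 - cos ψ)` plus a small cross term is positive definite and decays
exponentially along the closed-loop vector field. -/
theorem exists_strict_lyapunov (hv : 0 < v) (hmono : Monotone h) (hre : 0 < re)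
    (hbal : re * h re = v) (hG : ∀ x, HasDerivAt G (x * h x - v) x) (hGre : G re = 0)
    {β a b : ℝ} (hβ : 0 < β) (ha : 0 < a) (hreb : re ≤ b) :
    ∃ ε > 0, ∃ n > 0, ∃ ρ > 0, ∀ r ψ : ℝ, a ≤ r → r ≤ b → |ψ| ≤ π / 2 →
      n * ((r - re) ^ 2 + ψ ^ 2) ≤
        G r + v * r * (1 - Real.cos ψ) + ε * ((r - re) * ψ) ∧
      -(v * β * r * Real.sin ψ ^ 2) + ε * (v * Real.sin ψ * ψ +
          (r - re) * (-β * Real.sin ψ - h r + v / r * Real.cos ψ)) ≤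
        -ρ * (G r + v * r * (1 - Real.cos ψ) + ε * ((r - re) * ψ)) := by
  have hb : 0 < b := hre.trans_le hreb
  have hπ := Real.pi_pos
  obtain ⟨m, hm⟩ : ∃ m, m = v / (b * re) := ⟨_, rfl⟩
  obtain ⟨A, hA⟩ : ∃ A, A = β + v / a := ⟨_, rfl⟩
  obtain ⟨M, hM⟩ : ∃ M, M = v + A ^ 2 / (2 * m) := ⟨_, rfl⟩
  obtain ⟨κ, hκ⟩ : ∃ κ, κ = v * β * a * (2 / π) ^ 2 := ⟨_, rfl⟩
  obtain ⟨n, hn⟩ : ∃ n, n = min (v / (2 * re)) (v * a * (2 / π ^ 2)) := ⟨_, rfl⟩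
  obtain ⟨ε, hε⟩ : ∃ ε, ε = min n (κ / (2 * M)) := ⟨_, rfl⟩
  obtain ⟨ρ, hρ⟩ : ∃ ρ, ρ = min (ε / (4 * b)) (κ / (2 * (v * b))) := ⟨_, rfl⟩
  have hm0 : 0 < m := by rw [hm]; positivity
  have hA0 : 0 < A := by rw [hA]; positivity
  have hM0 : 0 < M := by rw [hM]; positivity
  have hκ0 : 0 < κ := by rw [hκ]; positivity
  have hn0 : 0 < n := by rw [hn]; positivity
  have hε0 : 0 < ε := by rw [hε]; positivity
  have hρ0 : 0 < ρ := by rw [hρ]; positivity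
  have hn1 : n ≤ v / (2 * re) := by rw [hn]; exact min_le_left _ _
  have hn2 : n ≤ v * a * (2 / π ^ 2) := by rw [hn]; exact min_le_right _ _
  have hε1 : ε ≤ n := by rw [hε]; exact min_le_left _ _
  have hε2 : ε * M ≤ κ / 2 := by
    have : ε ≤ κ / (2 * M) := by rw [hε]; exact min_le_right _ _
    rw [le_div_iff₀ (by positivity)] at this
    linarith
  have hρ1 : ρ * (2 * b) ≤ ε / 2 := by
    have : ρ ≤ ε / (4 * b) := by rw [hρ]; exact min_le_left _ _
    rw [le_div_iff₀ (by positivity)] at this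
    linarith
  have hρ2 : ρ * (v * b) ≤ κ / 2 := by
    have : ρ ≤ κ / (2 * (v * b)) := by rw [hρ]; exact min_le_right _ _
    rw [le_div_iff₀ (by positivity)] at this
    linarith
  refine ⟨ε, hε0, n / 2, by positivity, ρ, hρ0, fun r ψ har hrb hψ => ?_⟩
  have hr : 0 < r := ha.trans_le har
  have hsin : |Real.sin ψ| ≤ |ψ| := Real.abs_sin_le_abs
  have hcos1 : 1 - Real.cos ψ ≤ ψ ^ 2 / 2 := by
    linarith [Real.one_sub_sq_div_two_le_cos (x := ψ)]
  have hcos0 : 0 ≤ 1 - Real.cos ψ := by linarith [Real.cos_le_one ψ]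
  have hcos2 : 2 / π ^ 2 * ψ ^ 2 ≤ 1 - Real.cos ψ := by
    linarith [Real.cos_le_one_sub_mul_cos_sq (x := ψ) (by linarith)]
  have hcos3 : 1 - Real.cos ψ ≤ |ψ| := by
    have : |ψ| ≤ 2 := by linarith [Real.pi_le_four]
    nlinarith [sq_abs ψ, abs_nonneg ψ]
  have hsin2 : (2 / π) ^ 2 * ψ ^ 2 ≤ Real.sin ψ ^ 2 := by
    have h1 := pow_le_pow_left₀ (by positivity) (Real.mul_abs_le_abs_sin hψ) 2
    rwa [mul_pow, sq_abs, sq_abs] at h1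
  have hGlow := quadratic_le_potential hv hmono hre hbal hG hGre hr
  have hGup := potential_le_force hv hmono hre hbal hG hGre hr hrb hreb
  have hforce : m * (r - re) ^ 2 ≤ (r - re) * (h r - v / r) := by
    refine le_trans ?_ (div_mul_sq_le_force hmono hre hbal hr)
    rw [hm]
    gcongr
  have hE : n * ((r - re) ^ 2 + ψ ^ 2) ≤ G r + v * r * (1 - Real.cos ψ) := by
    have h1 : n * (r - re) ^ 2 ≤ G r :=
      (mul_le_mul_of_nonneg_right hn1 (sq_nonneg _)).trans hGlow
    have h2 : n * ψ ^ 2 ≤ v * r * (1 - Real.cos ψ) :=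
      calc n * ψ ^ 2 ≤ v * a * (2 / π ^ 2) * ψ ^ 2 :=
            mul_le_mul_of_nonneg_right hn2 (sq_nonneg _)
        _ = v * a * (2 / π ^ 2 * ψ ^ 2) := by ring
        _ ≤ v * r * (1 - Real.cos ψ) := by gcongr
    linarith
  have hX : |ε * ((r - re) * ψ)| ≤ n / 2 * ((r - re) ^ 2 + ψ ^ 2) := by
    rw [abs_mul, abs_of_pos hε0]
    have h1 : |(r - re) * ψ| ≤ ((r - re) ^ 2 + ψ ^ 2) / 2 := by
      have h2 := two_mul_le_add_sq |r - re| |ψ|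
      rw [sq_abs, sq_abs] at h2
      rw [abs_mul]
      linarith only [h2]
    calc ε * |(r - re) * ψ| ≤ n * (((r - re) ^ 2 + ψ ^ 2) / 2) := by gcongr
      _ = _ := by ring
  have hX' := abs_le.1 hX
  refine ⟨by linarith, ?_⟩
  obtain ⟨P, hP⟩ : ∃ P, P = (r - re) * (h r - v / r) := ⟨_, rfl⟩
  rw [← hP] at hGup hforce
  have hcross : (r - re) * (-β * Real.sin ψ - v / r * (1 - Real.cos ψ)) ≤
      A * (|r - re| * |ψ|) := by
    have h1 : |-β * Real.sin ψ - v / r * (1 - Real.cos ψ)| ≤ A * |ψ| := by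
      have h2 : |-β * Real.sin ψ| ≤ β * |ψ| := by
        rw [abs_mul, abs_neg, abs_of_pos hβ]; gcongr
      have h3 : |v / r * (1 - Real.cos ψ)| ≤ v / a * |ψ| := by
        rw [abs_of_nonneg (by positivity)]; gcongr
      calc _ ≤ |-β * Real.sin ψ| + |v / r * (1 - Real.cos ψ)| := abs_sub _ _
        _ ≤ _ := by rw [hA]; linarith
    calc _ ≤ |(r - re) * (-β * Real.sin ψ - v / r * (1 - Real.cos ψ))| := le_abs_self _
      _ = |r - re| * |-β * Real.sin ψ - v / r * (1 - Real.cos ψ)| := abs_mul _ _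
      _ ≤ |r - re| * (A * |ψ|) := by gcongr
      _ = _ := by ring
  have hyoung : A * (|r - re| * |ψ|) ≤ m / 2 * (r - re) ^ 2 + A ^ 2 / (2 * m) * ψ ^ 2 := by
    have h1 : 0 ≤ (m * |r - re| - A * |ψ|) ^ 2 / (2 * m) := by positivity
    have h2 : (m * |r - re| - A * |ψ|) ^ 2 / (2 * m) =
        m / 2 * |r - re| ^ 2 + A ^ 2 / (2 * m) * |ψ| ^ 2 - A * (|r - re| * |ψ|) := by
      field_simp; ring
    rw [h2, sq_abs, sq_abs] at h1
    linarith
  have hs : v * Real.sin ψ * ψ ≤ v * ψ ^ 2 := by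
    have : Real.sin ψ * ψ ≤ ψ ^ 2 := by
      calc Real.sin ψ * ψ ≤ |Real.sin ψ * ψ| := le_abs_self _
        _ = |Real.sin ψ| * |ψ| := abs_mul _ _
        _ ≤ |ψ| * |ψ| := by gcongr
        _ = ψ ^ 2 := by rw [← sq, sq_abs]
    rw [mul_assoc]
    gcongr
  have hXdot : v * Real.sin ψ * ψ +
      (r - re) * (-β * Real.sin ψ - h r + v / r * Real.cos ψ) ≤ -P / 2 + M * ψ ^ 2 := by
    have h1 : (r - re) * (-β * Real.sin ψ - h r + v / r * Real.cos ψ) =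
        (r - re) * (-β * Real.sin ψ - v / r * (1 - Real.cos ψ)) - P := by rw [hP]; ring
    have h2 : M * ψ ^ 2 = v * ψ ^ 2 + A ^ 2 / (2 * m) * ψ ^ 2 := by rw [hM]; ring
    linarith
  have hdiss : κ * ψ ^ 2 ≤ v * β * r * Real.sin ψ ^ 2 := by
    rw [hκ, mul_assoc]
    gcongr
  have hP0 : 0 ≤ P := le_trans (by positivity) hforce
  have hup : G r + v * r * (1 - Real.cos ψ) + ε * ((r - re) * ψ) ≤
      2 * b * P + v * b * ψ ^ 2 := by
    have h1 : v * r * (1 - Real.cos ψ) ≤ v * b * (ψ ^ 2 / 2) := by gcongr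
    linarith
  have h1 := mul_le_mul_of_nonneg_left hup hρ0.le
  have h2 := mul_le_mul_of_nonneg_left hXdot hε0.le
  have h3 := mul_le_mul_of_nonneg_right hρ1 hP0
  have h4 := mul_le_mul_of_nonneg_right hρ2 (sq_nonneg ψ)
  have h5 := mul_le_mul_of_nonneg_right hε2 (sq_nonneg ψ)
  linarith

end Potential

/-- Along the closed loop in polar coordinates, with `ψ` the heading measured from the
counterclockwise tangent, the state converges exponentially to `(re, 0)`. -/
theorem exists_exponential_bound {h r ψ : ℝ → ℝ} {v re β rd t₀ : ℝ} (hv : 0 < v) (hβ : 0 < β)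
    (hcont : Continuous h) (hmono : StrictMono h) (hrd : 0 < rd) (hrd0 : h rd = 0)
    (hhβ : ∀ x, |h x| < β) (hre : 0 < re) (hbal : re * h re = v)
    (hrpos : ∀ t, t₀ ≤ t → 0 < r t) (hψ0 : |ψ t₀| ≤ π / 2)
    (hdr : ∀ t, t₀ ≤ t → HasDerivAt r (v * Real.sin (ψ t)) t)
    (hdψ : ∀ t, t₀ ≤ t → HasDerivAt ψ
      (-β * Real.sin (ψ t) - h (r t) + v / r t * Real.cos (ψ t)) t) :
    ∃ T, t₀ ≤ T ∧ ∃ K, ∃ ρ > 0, ∀ t, T ≤ t →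
      (r t - re) ^ 2 + ψ t ^ 2 ≤ K * Real.exp (-ρ * (t - T)) := by
  have hψ : ∀ t, t₀ ≤ t → |ψ t| ≤ π / 2 := by
    intro t ht
    have h0 := abs_le.1 hψ0
    refine abs_le.2 ⟨?_, le_of_deriv_neg_at_level hdψ h0.2 ?_ ht⟩
    · refine neg_le.1 (le_of_deriv_neg_at_level (f := fun t => -ψ t)
        (fun s hs => (hdψ s hs).neg) (neg_le.1 h0.1) ?_ ht)
      intro s _ hs
      rw [show ψ s = -(π / 2) from neg_eq_iff_eq_neg.1 hs, Real.sin_neg, Real.cos_neg,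
        Real.sin_pi_div_two, Real.cos_pi_div_two]
      linarith [(abs_lt.1 (hhβ (r s))).2]
    · intro s _ hs
      rw [hs, Real.sin_pi_div_two, Real.cos_pi_div_two]
      linarith [(abs_lt.1 (hhβ (r s))).1]
  have hcos : ∀ t, t₀ ≤ t → 0 ≤ Real.cos (ψ t) := fun t ht =>
    Real.cos_nonneg_of_mem_Icc (abs_le.1 (hψ t ht))
  obtain ⟨G, hG, hGre⟩ : ∃ G : ℝ → ℝ, (∀ x, HasDerivAt G (x * h x - v) x) ∧ G re = 0 := by
    refine ⟨fun x => ∫ y in re..x, (y * h y - v), fun x => ?_, intervalIntegral.integral_same⟩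
    exact (Continuous.integral_hasStrictDerivAt (by fun_prop) re x).hasDerivAt
  obtain ⟨E, hE⟩ : ∃ E : ℝ → ℝ, ∀ t, E t = G (r t) + v * r t * (1 - Real.cos (ψ t)) :=
    ⟨_, fun _ => rfl⟩
  have hdE : ∀ t, t₀ ≤ t → HasDerivAt E (-(v * β * r t * Real.sin (ψ t) ^ 2)) t := by
    intro t ht
    have hr := (hrpos t ht).ne'
    rw [funext hE]
    refine (((hG (r t)).comp t (hdr t ht)).add
      (((hdr t ht).const_mul v).mul ((hdψ t ht).cos.const_sub 1))).congr_deriv ?_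
    field_simp
    ring
  have hEanti : AntitoneOn E (Set.Ici t₀) := antitoneOn_Ici_of_hasDerivAt_nonpos hdE fun t ht => by
    have := hrpos t ht
    exact neg_nonpos.2 (by positivity)
  have hGE : ∀ t, t₀ ≤ t → G (r t) ≤ E t := fun t ht => by
    have h1 : 0 ≤ v * r t * (1 - Real.cos (ψ t)) :=
      mul_nonneg (mul_nonneg hv.le (hrpos t ht).le) (sub_nonneg.2 (Real.cos_le_one _))
    rw [hE]
    linarith
  obtain ⟨T, hT, a, ha, har⟩ : ∃ T, t₀ ≤ T ∧ ∃ a > 0, ∀ t, T ≤ t → a ≤ r t := by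
    by_cases hlow : ∃ T, t₀ ≤ T ∧ E T < G 0
    · obtain ⟨T, hT, hET⟩ := hlow
      obtain ⟨a, ha, haG⟩ := Metric.eventually_nhds_iff.1
        ((hG 0).continuousAt.eventually (lt_mem_nhds hET))
      refine ⟨T, hT, a, ha, fun t ht => ?_⟩
      by_contra! hra
      have h1 := haG (y := r t) (by
        rwa [Real.dist_eq, sub_zero, abs_of_pos (hrpos t (hT.trans ht))])
      have h2 := hGE t (hT.trans ht)
      have h3 := hEanti (Set.mem_Ici.2 hT) (Set.mem_Ici.2 (hT.trans ht)) ht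
      linarith
    · push Not at hlow
      refine ⟨t₀, le_rfl, rd, hrd, fun t ht => ?_⟩
      by_contra! hrr
      have hr := hrpos t ht
      obtain ⟨c, hc, hcs⟩ := exists_hasDerivAt_eq_slope G (fun x => x * h x - v) hr
        (fun x _ => (hG x).continuousAt.continuousWithinAt) fun x _ => hG x
      have hneg : c * h c < 0 :=
        mul_neg_of_pos_of_neg hc.1 (hrd0 ▸ hmono (hc.2.trans hrr))
      rw [sub_zero, eq_div_iff hr.ne'] at hcs
      have h1 := hlow t ht
      rw [hE] at h1
      have h2 := mul_nonneg (mul_nonneg hv.le hr.le) (hcos t ht)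
      have h3 := mul_neg_of_neg_of_pos hneg hr
      linarith
  obtain ⟨b, hreb, hrb⟩ : ∃ b, re ≤ b ∧ ∀ t, t₀ ≤ t → r t ≤ b := by
    have hbound : ∀ t, t₀ ≤ t → (r t - re) ^ 2 ≤ E t₀ / (v / (2 * re)) := by
      intro t ht
      rw [le_div_iff₀ (by positivity), mul_comm]
      exact (quadratic_le_potential hv hmono.monotone hre hbal hG hGre (hrpos t ht)).trans
        ((hGE t ht).trans (hEanti Set.self_mem_Ici ht ht))
    refine ⟨re + (E t₀ / (v / (2 * re)) + 1), ?_, fun t ht => ?_⟩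
    · linarith [(sq_nonneg _).trans (hbound t₀ le_rfl)]
    · nlinarith [hbound t ht, sq_nonneg (r t - re - 1)]
  obtain ⟨ε, -, n, hn, ρ, hρ, hlyap⟩ := exists_strict_lyapunov hv hmono.monotone hre hbal hG hGre
    hβ ha hreb
  have hdW : ∀ t, T ≤ t → HasDerivAt (fun t => E t + ε * ((r t - re) * ψ t)) _ t := fun t ht =>
    (hdE t (hT.trans ht)).add ((((hdr t (hT.trans ht)).sub_const re).mul
      (hdψ t (hT.trans ht))).const_mul ε)
  refine ⟨T, hT, (E T + ε * ((r T - re) * ψ T)) / n, ρ, hρ, fun t ht => ?_⟩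
  have hdecay := le_mul_exp_of_deriv_le_neg_mul (ρ := ρ) hdW (fun s hs => by
    have := (hlyap (r s) (ψ s) (har s hs) (hrb s (hT.trans hs)) (hψ s (hT.trans hs))).2
    rwa [← hE] at this) ht
  have hpos := (hlyap (r t) (ψ t) (har t ht) (hrb t (hT.trans ht)) (hψ t (hT.trans ht))).1
  rw [← hE] at hpos
  rw [div_mul_eq_mul_div, le_div_iff₀ hn]
  linarith

/-- An exponential bound can be restarted at a later time with a constant proportional to the
value there. -/
theorem exists_sqrt_exponential_bound {N : ℝ → ℝ} {T K ρ : ℝ} (hρ : 0 < ρ)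
    (hN : ∀ t, T ≤ t → N t ≤ K * Real.exp (-ρ * (t - T))) :
    ∃ t₁, T ≤ t₁ ∧ ∃ C > (0 : ℝ), ∃ ρ > (0 : ℝ), ∀ t, t₁ < t →
      Real.sqrt (N t) ≤ C * Real.sqrt (N t₁) * Real.exp (-ρ * (t - t₁)) := by
  by_cases hex : ∃ t₁, T ≤ t₁ ∧ 0 < N t₁
  · obtain ⟨t₁, ht₁, hpos⟩ := hex
    have hK : 0 < K := pos_of_mul_pos_left (hpos.trans_le (hN t₁ ht₁)) (Real.exp_pos _).le
    have hsq := Real.sqrt_pos.2 hpos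
    refine ⟨t₁, ht₁, Real.sqrt K * Real.exp (-(ρ / 2) * (t₁ - T)) / Real.sqrt (N t₁),
      by positivity, ρ / 2, half_pos hρ, fun t ht => ?_⟩
    rw [div_mul_cancel₀ _ hsq.ne', mul_assoc, ← Real.exp_add]
    refine (Real.sqrt_le_sqrt (hN t (ht₁.trans ht.le))).trans_eq ?_
    rw [Real.sqrt_mul hK.le, Real.sqrt_eq_rpow (Real.exp _), ← Real.exp_mul]
    congr 2
    ring
  · push Not at hex
    refine ⟨T, le_rfl, 1, one_pos, 1, one_pos, fun t ht => ?_⟩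
    rw [Real.sqrt_eq_zero'.2 (hex t ht.le)]
    positivity

/-- Global exponential regulation for the P-like controller in a circular field:
for any initial heading `φ(t0) ∈ [-π, 0]`, there is a finite time `t1 ≥ t0` after
which the state `(s(t), φ(t))` converges exponentially to the equilibrium
`(s_e, -π/2)`, where `s_e = s_d - α(r_e - r_d)` and `r_e` is the unique positive
root of `g(r) = -tanh(α(r - r_d)/c4) + v/(c1 c3 r)`. -/
theorem stmt_10 (v α rd c1 c3 c4 sd t0 : ℝ)
    (hv : 0 < v) (hα : 0 < α) (hrd : 0 < rd) (hc4 : 0 < c4) (hc1 : 0 < c1)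
    (hc3 : 0 < c3) (hc3' : c3 < α * v)
    (r φ : ℝ → ℝ)
    (hrpos : ∀ t : ℝ, t0 ≤ t → 0 < r t)
    (hφ0 : φ t0 ∈ Set.Icc (-π) 0)
    (hdr : ∀ t : ℝ, t0 ≤ t → HasDerivAt r (v * Real.cos (φ t)) t)
    (hdφ : ∀ t : ℝ, t0 ≤ t → HasDerivAt φ
      (c1 * (-(α * v) * Real.cos (φ t) - c3 * Real.tanh (α * (r t - rd) / c4))
        - (v / r t) * Real.sin (φ t)) t)
    (s : ℝ → ℝ) (hs : ∀ t : ℝ, s t = sd - α * (r t - rd))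
    (re : ℝ) (hre : 0 < re)
    (hroot : -Real.tanh (α * (re - rd) / c4) + v / (c1 * c3 * re) = 0)
    (se : ℝ) (hse : se = sd - α * (re - rd)) :
    ∃ t1 : ℝ, t0 ≤ t1 ∧ ∃ C > (0 : ℝ), ∃ ρ > (0 : ℝ), ∀ t : ℝ, t1 < t →
      Real.sqrt ((s t - se) ^ 2 + (φ t + π / 2) ^ 2) ≤
        C * Real.sqrt ((s t1 - se) ^ 2 + (φ t1 + π / 2) ^ 2) *
          Real.exp (-ρ * (t - t1)) := by
  have hc13 : 0 < c1 * c3 := mul_pos hc1 hc3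
  have hbal : re * (c1 * c3 * Real.tanh (α * (re - rd) / c4)) = v := by
    have h1 : Real.tanh (α * (re - rd) / c4) = v / (c1 * c3 * re) := by linarith
    rw [h1]
    field_simp
  obtain ⟨T, hT, K, ρ, hρ, hbound⟩ := exists_exponential_bound
    (h := fun x => c1 * c3 * Real.tanh (α * (x - rd) / c4)) (r := r)
    (ψ := fun t => φ t + π / 2) (v := v) (re := re) (β := c1 * (α * v)) (rd := rd) (t₀ := t0)
    hv (by positivity) (continuous_const.mul (continuous_tanh_real.comp (by fun_prop)))
    (fun x y hxy => mul_lt_mul_of_pos_left (tanh_strictMono_real (by gcongr)) hc13) hrd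
    (by simp) (fun x => by
      rw [abs_mul, abs_of_pos hc13, mul_assoc]
      have h1 := Real.abs_tanh_lt_one (α * (x - rd) / c4)
      have h2 := mul_lt_mul_of_pos_left h1 hc3
      exact mul_lt_mul_of_pos_left (by linarith) hc1)
    hre hbal hrpos
    (abs_le.2 ⟨by linarith [hφ0.1], by linarith [hφ0.2]⟩)
    (fun t ht => (hdr t ht).congr_deriv (by rw [Real.sin_add_pi_div_two]))
    (fun t ht => ((hdφ t ht).add_const (π / 2)).congr_deriv (by
      rw [Real.sin_add_pi_div_two, Real.cos_add_pi_div_two]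
      ring))
  obtain ⟨t1, ht1, C, hC, σ, hσ, hfin⟩ := exists_sqrt_exponential_bound
    (N := fun t => (s t - se) ^ 2 + (φ t + π / 2) ^ 2) (T := T) (K := (α ^ 2 + 1) * K) (ρ := ρ)
    hρ (fun t ht => by
      have h1 := mul_le_mul_of_nonneg_left (hbound t ht) (show 0 ≤ α ^ 2 + 1 by positivity)
      have h2 : s t - se = -α * (r t - re) := by rw [hs, hse]; ring
      rw [h2]
      nlinarith [sq_nonneg (r t - re), mul_nonneg (sq_nonneg α) (sq_nonneg (φ t + π / 2))])
  exact ⟨t1, hT.trans ht1, C, hC, σ, hσ, hfin⟩
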